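/- For all 1 ≤ ℓ ≤ κ ≤ m and all w ∈ ℝ^m, the second partial derivative of H_p satisfies ∂²H_p/∂w_ℓ∂w_κ (w) = p(p−1) · Σ_{p_{m−1}=0}^{p−2} Σ_{p_{m−2}=0}^{p_{m−1}} ··· Σ_{p_1=0}^{p_2} C(p−2,p_{m−1})·C(p_{m−1},p_{m−2})···C(p_2,p_1) · (∏_{k=1}^{ℓ−1} θ_k^{p_k²}) · (∏_{k=ℓ}^{κ−1} θ_k^{(p_k+1)²}) · (∏_{k=κ}^{m−1} θ_k^{(p_k+2)²}) · w_1^{p_1} w_2^{p_2−p_1} ··· w_m^{(p−2)−p_{m−1}} (with empty products understood as 1; the case ℓ = κ gives the pure second derivatives). -/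

import Mathlib

open Real Finset

/-- Chains `0 = q 0 ≤ q 1 ≤ ⋯ ≤ q m = n`. -/
def chains (m n : ℕ) : Finset (Fin (m + 1) → ℕ) :=
  (Fintype.piFinset fun _ : Fin (m + 1) => Finset.range (n + 1)).filter
    (fun q => (∀ i j : Fin (m + 1), i ≤ j → q i ≤ q j) ∧ q 0 = 0 ∧ q (Fin.last m) = n)

theorem mem_chains {m n : ℕ} {q : Fin (m + 1) → ℕ} :
    q ∈ chains m n ↔
      (∀ i j : Fin (m + 1), i ≤ j → q i ≤ q j) ∧ q 0 = 0 ∧ q (Fin.last m) = n := by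
  simp only [chains, Finset.mem_filter, Fintype.mem_piFinset, Finset.mem_range,
    and_iff_right_iff_imp]
  rintro ⟨h, -, rfl⟩ i
  exact Nat.lt_succ_of_le (h i _ (Fin.le_last i))

/-- Raise by one all entries of a chain after position `κ`. -/
def raiseAfter {m : ℕ} (κ : Fin m) (q : Fin (m + 1) → ℕ) : Fin (m + 1) → ℕ :=
  fun i => if κ.castSucc < i then q i + 1 else q i

/-- The sum over chains of multinomial coefficients times weights times monomials. -/
noncomputable def chainSum (m n : ℕ) (F : (Fin (m + 1) → ℕ) → ℝ) (w : Fin m → ℝ) : ℝ :=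
  ∑ q ∈ chains m n, (∏ j : Fin m, ((q j.succ).choose (q j.castSucc) : ℝ)) * F q *
    (∏ j : Fin m, w j ^ (q j.succ - q j.castSucc))

theorem prod_choose_mul_prod_factorial {m n : ℕ} {q : Fin (m + 1) → ℕ} (hq : q ∈ chains m n) :
    (∏ j : Fin m, (q j.succ).choose (q j.castSucc)) *
      ∏ j : Fin m, (q j.succ - q j.castSucc).factorial = n.factorial := by
  obtain ⟨hmono, h0, hn⟩ := mem_chains.1 hq
  have key : ((∏ j : Fin m, (q j.succ).choose (q j.castSucc)) *
      ∏ j : Fin m, (q j.succ - q j.castSucc).factorial) * ∏ j : Fin m, (q j.castSucc).factorial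
      = ∏ j : Fin m, (q j.succ).factorial := by
    rw [← Finset.prod_mul_distrib, ← Finset.prod_mul_distrib]
    refine Finset.prod_congr rfl fun j _ => ?_
    rw [← Nat.choose_mul_factorial_mul_factorial (hmono _ _ j.castSucc_lt_succ.le)]
    ring
  have h1 := Fin.prod_univ_succ fun i : Fin (m + 1) => (q i).factorial
  rw [Fin.prod_univ_castSucc, h0, hn, Nat.factorial_zero, one_mul, ← key] at h1
  have hpos : 0 < ∏ j : Fin m, (q j.castSucc).factorial :=
    Finset.prod_pos fun j _ => Nat.factorial_pos _
  refine Nat.eq_of_mul_eq_mul_right hpos ?_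
  rw [← h1, mul_comm]

theorem raiseAfter_succ_sub_castSucc {m : ℕ} {κ : Fin m} {q : Fin (m + 1) → ℕ}
    (hq : ∀ i j : Fin (m + 1), i ≤ j → q i ≤ q j) (j : Fin m) :
    raiseAfter κ q j.succ - raiseAfter κ q j.castSucc =
      q j.succ - q j.castSucc + if j = κ then 1 else 0 := by
  have := hq _ _ j.castSucc_lt_succ.le
  simp only [raiseAfter, Fin.lt_def, Fin.val_castSucc, Fin.val_succ, Fin.ext_iff]
  split_ifs <;> omega

theorem raiseAfter_mem_chains {m n : ℕ} (κ : Fin m) {q : Fin (m + 1) → ℕ}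
    (hq : q ∈ chains m n) : raiseAfter κ q ∈ chains m (n + 1) := by
  obtain ⟨hmono, h0, hn⟩ := mem_chains.1 hq
  refine mem_chains.2 ⟨fun i j hij => ?_, ?_, ?_⟩
  · have := hmono i j hij
    simp only [raiseAfter, Fin.lt_def]
    rw [Fin.le_def] at hij
    split_ifs <;> omega
  · simp [raiseAfter, h0]
  · simp [raiseAfter, hn, Fin.castSucc_lt_last]

theorem raiseAfter_injective {m : ℕ} (κ : Fin m) : Function.Injective (raiseAfter κ) := by
  intro q r h
  ext i
  have := congrFun h i
  simp only [raiseAfter] at this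
  split_ifs at this <;> omega

theorem exists_raiseAfter_eq {m n : ℕ} {κ : Fin m} {q : Fin (m + 1) → ℕ}
    (hq : q ∈ chains m (n + 1)) (hκ : q κ.castSucc < q κ.succ) :
    ∃ r ∈ chains m n, raiseAfter κ r = q := by
  obtain ⟨hmono, h0, hn⟩ := mem_chains.1 hq
  have hpos : ∀ i : Fin (m + 1), κ.castSucc < i → q κ.castSucc < q i := fun i hi =>
    hκ.trans_le (hmono _ _ (Fin.castSucc_lt_iff_succ_le.1 hi))
  refine ⟨fun i => if κ.castSucc < i then q i - 1 else q i,
    mem_chains.2 ⟨fun i j hij => ?_, ?_, ?_⟩, ?_⟩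
  · have hle := hmono i j hij
    by_cases hi : κ.castSucc < i
    · simp only [hi, hi.trans_le hij, if_true]
      omega
    · by_cases hj : κ.castSucc < j
      · have h1 := hmono i κ.castSucc (not_lt.1 hi)
        have h2 := hpos j hj
        simp only [hi, hj, if_true, if_false]
        omega
      · simpa only [hi, hj, if_false] using hle
  · simp [h0]
  · simp [hn, Fin.castSucc_lt_last]
  · ext i
    simp only [raiseAfter]
    split_ifs with hi
    · have := hpos i hi
      omega
    · rfl

theorem prod_choose_raiseAfter {m n : ℕ} (κ : Fin m) {q : Fin (m + 1) → ℕ}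
    (hq : q ∈ chains m n) :
    (∏ j : Fin m, (raiseAfter κ q j.succ).choose (raiseAfter κ q j.castSucc)) *
        (q κ.succ - q κ.castSucc + 1) =
      (n + 1) * ∏ j : Fin m, (q j.succ).choose (q j.castSucc) := by
  have h1 := prod_choose_mul_prod_factorial hq
  have h2 := prod_choose_mul_prod_factorial (raiseAfter_mem_chains κ hq)
  have h3 : ∏ j : Fin m, (raiseAfter κ q j.succ - raiseAfter κ q j.castSucc).factorial =
      (q κ.succ - q κ.castSucc + 1) * ∏ j : Fin m, (q j.succ - q j.castSucc).factorial := by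
    simp only [raiseAfter_succ_sub_castSucc (mem_chains.1 hq).1]
    rw [Fintype.prod_eq_mul_prod_compl κ, Fintype.prod_eq_mul_prod_compl κ, if_pos rfl,
      Nat.factorial_succ, mul_assoc]
    congr 2
    refine Finset.prod_congr rfl fun j hj => ?_
    rw [if_neg (by simpa using hj), add_zero]
  have hpos : 0 < ∏ j : Fin m, (q j.succ - q j.castSucc).factorial :=
    Finset.prod_pos fun j _ => Nat.factorial_pos _
  refine Nat.eq_of_mul_eq_mul_right hpos ?_
  rw [mul_assoc, ← h3, h2, mul_assoc, h1, Nat.factorial_succ]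

theorem fderiv_prod_pow_single {ι : Type*} [Fintype ι] [DecidableEq ι] (e : ι → ℕ) (κ : ι)
    (w : ι → ℝ) :
    fderiv ℝ (fun v : ι → ℝ => ∏ j, v j ^ e j) w (Pi.single κ 1) =
      e κ * w κ ^ (e κ - 1) * ∏ j ∈ {κ}ᶜ, w j ^ e j := by
  have h : ∀ j ∈ (Finset.univ : Finset ι), HasFDerivAt (fun v : ι → ℝ => v j ^ e j)
      ((e j * w j ^ (e j - 1)) • ContinuousLinearMap.proj (R := ℝ) (φ := fun _ : ι => ℝ) j) w := by
    intro j _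
    simpa using (hasFDerivAt_apply (𝕜 := ℝ) (F' := fun _ : ι => ℝ) j w).pow (e j)
  rw [(HasFDerivAt.finsetProd h).fderiv, _root_.sum_apply,
    Finset.sum_eq_single κ]
  · simp [mul_comm, Finset.compl_eq_univ_sdiff, Finset.sdiff_singleton_eq_erase]
  · intro j _ hj
    simp [Pi.single_eq_of_ne hj]
  · simp

theorem fderiv_chainSum_single {m : ℕ} (n : ℕ) (F : (Fin (m + 1) → ℕ) → ℝ) (κ : Fin m)
    (w : Fin m → ℝ) :
    fderiv ℝ (chainSum m (n + 1) F) w (Pi.single κ 1) =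
      (n + 1) * chainSum m n (F ∘ raiseAfter κ) w := by
  have hd : ∀ q : Fin (m + 1) → ℕ, DifferentiableAt ℝ
      (fun v : Fin m → ℝ => ∏ j : Fin m, v j ^ (q j.succ - q j.castSucc)) w := by
    intro q
    fun_prop
  unfold chainSum
  rw [fderiv_fun_sum fun q _ => (hd q).const_mul _, _root_.sum_apply,
    Finset.mul_sum]
  simp_rw [fderiv_const_mul (hd _)]
  symm
  refine Finset.sum_of_injOn (raiseAfter κ) (raiseAfter_injective κ).injOn
    (fun q hq => raiseAfter_mem_chains κ hq) (fun q hq hnot => ?_) (fun q hq => ?_)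
  · have : q κ.succ - q κ.castSucc = 0 := by
      by_contra hne
      exact hnot (exists_raiseAfter_eq hq (by omega))
    rw [_root_.smul_apply, fderiv_prod_pow_single, this]
    simp
  · rw [_root_.smul_apply, fderiv_prod_pow_single]
    simp only [raiseAfter_succ_sub_castSucc (mem_chains.1 hq).1, if_true, Nat.add_sub_cancel,
      Function.comp_apply, smul_eq_mul]
    have h1 : ∏ j ∈ ({κ}ᶜ : Finset (Fin m)),
        w j ^ (q j.succ - q j.castSucc + if j = κ then 1 else 0) =
        ∏ j ∈ ({κ}ᶜ : Finset (Fin m)), w j ^ (q j.succ - q j.castSucc) := by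
      refine Finset.prod_congr rfl fun j hj => ?_
      rw [if_neg (by simpa using hj), add_zero]
    have h2 := congrArg (Nat.cast : ℕ → ℝ) (prod_choose_raiseAfter κ hq)
    simp only [Nat.cast_mul, Nat.cast_prod, Nat.cast_add, Nat.cast_one] at h2 ⊢
    rw [h1, Fintype.prod_eq_mul_prod_compl κ (fun j => w j ^ (q j.succ - q j.castSucc))]
    linear_combination -(F (raiseAfter κ q) * w κ ^ (q κ.succ - q κ.castSucc) *
      ∏ j ∈ ({κ}ᶜ : Finset (Fin m)), w j ^ (q j.succ - q j.castSucc)) * h2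



/-- Second partial derivatives of the homogeneous Lyapunov polynomial
`H_p`.  Chains `0 ≤ p_1 ≤ ... ≤ p_{m-1} ≤ p` are encoded as monotone tuples
`q : Fin (m+1) → ℕ` with `q 0 = 0` and `q m = p` (resp. `p - 2` for the derivative sum).
The mixed second partial derivative `∂²H_p/∂w_ℓ∂w_κ (w)` is rendered as
`fderiv ℝ (fun v => fderiv ℝ H v (Pi.single κ 1)) w (Pi.single ℓ 1)`; indices `ℓ ≤ κ`
are `0`-based (paper's `ℓ` is `(ℓ : ℕ) + 1`), and `θ k` is the paper's `θ_{k+1}`.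
The case `ℓ = κ` gives the pure second derivatives. -/
theorem stmt9 (m p : ℕ) (hm : 2 ≤ m) (hp : 2 ≤ p)
    (θ : Fin (m - 1) → ℝ) (hθ : ∀ k, 0 < θ k)
    (H : (Fin m → ℝ) → ℝ)
    (hH : ∀ w : Fin m → ℝ, H w =
      ∑ q ∈ (Fintype.piFinset fun _ : Fin (m + 1) => Finset.range (p + 1)).filter
          (fun q => (∀ i j : Fin (m + 1), i ≤ j → q i ≤ q j) ∧
            q 0 = 0 ∧ q (Fin.last m) = p),
        (∏ j : Fin m, ((q j.succ).choose (q j.castSucc) : ℝ)) *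
        (∏ k : Fin (m - 1), θ k ^ (q ⟨(k : ℕ) + 1, by have := k.isLt; omega⟩) ^ 2) *
        (∏ j : Fin m, w j ^ (q j.succ - q j.castSucc))) :
    ∀ (ℓ κ : Fin m), ℓ ≤ κ → ∀ w : Fin m → ℝ,
      fderiv ℝ (fun v => fderiv ℝ H v (Pi.single κ 1)) w (Pi.single ℓ 1) =
        (p : ℝ) * ((p : ℝ) - 1) *
          ∑ q ∈ (Fintype.piFinset fun _ : Fin (m + 1) => Finset.range (p - 1)).filter
              (fun q => (∀ i j : Fin (m + 1), i ≤ j → q i ≤ q j) ∧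
                q 0 = 0 ∧ q (Fin.last m) = p - 2),
            (∏ j : Fin m, ((q j.succ).choose (q j.castSucc) : ℝ)) *
            (∏ k : Fin (m - 1), θ k ^
              (if (k : ℕ) < (ℓ : ℕ) then (q ⟨(k : ℕ) + 1, by have := k.isLt; omega⟩) ^ 2
               else if (k : ℕ) < (κ : ℕ) then
                 ((q ⟨(k : ℕ) + 1, by have := k.isLt; omega⟩) + 1) ^ 2
               else ((q ⟨(k : ℕ) + 1, by have := k.isLt; omega⟩) + 2) ^ 2)) *
            (∏ j : Fin m, w j ^ (q j.succ - q j.castSucc)) := by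

  obtain ⟨n, rfl⟩ : ∃ n, p = n + 2 := ⟨p - 2, by omega⟩
  intro ℓ κ hℓκ w
  have hH' : H = chainSum m (n + 1 + 1) (fun q => ∏ k : Fin (m - 1),
      θ k ^ (q ⟨(k : ℕ) + 1, by have := k.isLt; omega⟩) ^ 2) := funext hH
  subst hH'
  simp_rw [fderiv_chainSum_single]
  have hd : DifferentiableAt ℝ (chainSum m (n + 1) ((fun q => ∏ k : Fin (m - 1),
      θ k ^ (q ⟨(k : ℕ) + 1, by have := k.isLt; omega⟩) ^ 2) ∘ raiseAfter κ)) w := by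
    unfold chainSum
    fun_prop
  rw [fderiv_const_mul hd, _root_.smul_apply, fderiv_chainSum_single, smul_eq_mul,
    ← mul_assoc]
  congr 1
  · push_cast
    ring
  · refine Finset.sum_congr rfl fun q _ => ?_
    refine congrArg₂ _ (congrArg₂ _ rfl ?_) rfl
    simp only [Function.comp_apply]
    refine Finset.prod_congr rfl fun k _ => ?_
    have hle : (ℓ : ℕ) ≤ κ := hℓκ
    simp only [raiseAfter, Fin.lt_def, Fin.val_castSucc]
    congr 1
    split_ifs <;> first | rfl | omega
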